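/- arXiv:1712.05310 — 2 statements merged into one kernel-verified Lean document; each statement's English description precedes it below -/
import Mathlib

section
/- Every formula of L_BAPAL is semantically equivalent to a formula in arbitrary announcement normal form: for every φ ∈ L_BAPAL there is ψ ∈ L_AANF such that for every epistemic model M and state s, M_s ⊨ φ iff M_s ⊨ ψ. -/
/-- Boolean (propositional) formulas over atoms `P`. -/
inductive PLForm (P : Type) : Type
  | atom : P → PLForm P
  | neg : PLForm P → PLForm P
  | and : PLForm P → PLForm P → PLForm P

/-- The language L_BAPAL over agents `A` and atoms `P`. -/
inductive Form (A P : Type) : Type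
  | atom : P → Form A P
  | neg : Form A P → Form A P
  | and : Form A P → Form A P → Form A P
  | know : A → Form A P → Form A P
  | ann : Form A P → Form A P → Form A P
  | box : Form A P → Form A P

def PLForm.toForm {A P : Type} : PLForm P → Form A P
  | .atom p => .atom p
  | .neg φ => .neg φ.toForm
  | .and φ ψ => .and φ.toForm ψ.toForm

structure Model (A P : Type) where
  S : Type
  rel : A → S → S → Prop
  val : P → S → Prop

/-- An epistemic model: each accessibility relation is an equivalence relation. -/
def Model.IsEpistemic {A P : Type} (M : Model A P) : Prop :=
  ∀ a : A, Equivalence (M.rel a)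

/-- Restriction of a model to a subset of its states. -/
def Model.restrict {A P : Type} (M : Model A P) (X : Set M.S) : Model A P where
  S := X
  rel a s t := M.rel a s.val t.val
  val p s := M.val p s.val

/-- Satisfaction of boolean formulas. -/
def SatPL {A P : Type} (M : Model A P) (s : M.S) : PLForm P → Prop
  | .atom p => M.val p s
  | .neg φ => ¬ SatPL M s φ
  | .and φ ψ => SatPL M s φ ∧ SatPL M s ψ

/-- BAPAL satisfaction. -/
def Sat {A P : Type} : (M : Model A P) → M.S → Form A P → Prop
  | M, s, .atom p => M.val p s
  | M, s, .neg φ => ¬ Sat M s φ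
  | M, s, .and φ ψ => Sat M s φ ∧ Sat M s ψ
  | M, s, .know a φ => ∀ t : M.S, M.rel a s t → Sat M t φ
  | M, s, .ann φ ψ => ∀ h : Sat M s φ, Sat (M.restrict {t | Sat M t φ}) ⟨s, h⟩ ψ
  | M, s, .box ψ => ∀ (φ₀ : PLForm P) (h : SatPL M s φ₀),
      Sat (M.restrict {t | SatPL M t φ₀}) ⟨s, h⟩ ψ

def Valid {A P : Type} (φ : Form A P) : Prop :=
  ∀ M : Model A P, M.IsEpistemic → ∀ s : M.S, Sat M s φ

def Form.imp {A P : Type} (φ ψ : Form A P) : Form A P := .neg (.and φ (.neg ψ))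
def Form.iff {A P : Type} (φ ψ : Form A P) : Form A P := .and (φ.imp ψ) (ψ.imp φ)
def Form.dia {A P : Type} (φ : Form A P) : Form A P := .neg (.box (.neg φ))
def Form.khat {A P : Type} (a : A) (φ : Form A P) : Form A P := .neg (.know a (.neg φ))
def Form.diaAnn {A P : Type} (φ ψ : Form A P) : Form A P := .neg (.ann φ (.neg ψ))

def Form.occurs {A P : Type} (q : P) : Form A P → Prop
  | .atom p => p = q
  | .neg φ => φ.occurs q
  | .and φ ψ => φ.occurs q ∨ ψ.occurs q
  | .know _ φ => φ.occurs q
  | .ann φ ψ => φ.occurs q ∨ ψ.occurs q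
  | .box φ => φ.occurs q

def Form.mapAtoms {A P Q : Type} (f : P → Q) : Form A P → Form A Q
  | .atom p => .atom (f p)
  | .neg φ => .neg (φ.mapAtoms f)
  | .and φ ψ => .and (φ.mapAtoms f) (ψ.mapAtoms f)
  | .know a φ => .know a (φ.mapAtoms f)
  | .ann φ ψ => .ann (φ.mapAtoms f) (ψ.mapAtoms f)
  | .box φ => .box (φ.mapAtoms f)

/-- Arbitrary announcement normal form: every announcement is paired with a `□` and
vice versa. -/
inductive IsAANF {A P : Type} : Form A P → Prop
  | atom (p : P) : IsAANF (.atom p)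
  | neg {φ} : IsAANF φ → IsAANF (.neg φ)
  | and {φ ψ} : IsAANF φ → IsAANF ψ → IsAANF (.and φ ψ)
  | know {φ} (a : A) : IsAANF φ → IsAANF (.know a φ)
  | annbox {φ ψ} : IsAANF φ → IsAANF ψ → IsAANF (.ann φ (.box ψ))

/-- An isomorphism of models: a bijection of states preserving relations and valuation. -/
structure Model.Iso {A P : Type} (M N : Model A P) where
  toEquiv : M.S ≃ N.S
  rel_iff : ∀ a s t, N.rel a (toEquiv s) (toEquiv t) ↔ M.rel a s t
  val_iff : ∀ p s, N.val p (toEquiv s) ↔ M.val p s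

/-- An isomorphism restricts to corresponding subsets of states. -/
def Model.Iso.restrict {A P : Type} {M N : Model A P} (f : M.Iso N) (X : Set M.S) (Y : Set N.S)
    (h : ∀ s, s ∈ X ↔ f.toEquiv s ∈ Y) : (M.restrict X).Iso (N.restrict Y) where
  toEquiv := f.toEquiv.subtypeEquiv h
  rel_iff a s t := f.rel_iff a s.val t.val
  val_iff p s := f.val_iff p s.val

/-- Restricting twice is restricting once to the states that survive both restrictions. -/
def Model.restrictRestrictIso {A P : Type} (M : Model A P) (X : Set M.S)
    (Y : Set (M.restrict X).S) (Z : Set M.S) (h : ∀ s, s ∈ Z ↔ ∃ hs : s ∈ X, ⟨s, hs⟩ ∈ Y) :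
    ((M.restrict X).restrict Y).Iso (M.restrict Z) where
  toEquiv :=
    { toFun := fun s => ⟨s.val.val, (h _).2 ⟨s.val.property, s.property⟩⟩
      invFun := fun s => ⟨⟨s.val, ((h _).1 s.property).1⟩, ((h _).1 s.property).2⟩
      left_inv := fun _ => rfl
      right_inv := fun _ => rfl }
  rel_iff _ _ _ := Iff.rfl
  val_iff _ _ := Iff.rfl

theorem Model.Iso.satPL_iff {A P : Type} {M N : Model A P} (f : M.Iso N) (s : M.S)
    (φ : PLForm P) : SatPL N (f.toEquiv s) φ ↔ SatPL M s φ := by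
  induction φ with
  | atom p => exact f.val_iff p s
  | neg φ ih => exact not_congr ih
  | and φ ψ ih₁ ih₂ => exact and_congr ih₁ ih₂

theorem Model.Iso.sat_iff {A P : Type} (φ : Form A P) :
    ∀ {M N : Model A P} (f : M.Iso N) (s : M.S), Sat N (f.toEquiv s) φ ↔ Sat M s φ := by
  induction φ with
  | atom p => exact fun f s => f.val_iff p s
  | neg φ ih => exact fun f s => not_congr (ih f s)
  | and φ ψ ih₁ ih₂ => exact fun f s => and_congr (ih₁ f s) (ih₂ f s)
  | know a φ ih =>
    intro M N f s
    simp only [Sat]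
    rw [← f.toEquiv.forall_congr_right]
    exact forall_congr' fun t => imp_congr (f.rel_iff a s t) (ih f t)
  | ann φ ψ ih₁ ih₂ =>
    intro M N f s
    have e := fun h =>
      ih₂ (f.restrict {t | Sat M t φ} {t | Sat N t φ} fun t => (ih₁ f t).symm) ⟨s, h⟩
    exact ⟨fun H h => (e h).1 (H ((ih₁ f s).2 h)), fun H h => (e ((ih₁ f s).1 h)).2 (H _)⟩
  | box ψ ih =>
    intro M N f s
    refine forall_congr' fun φ₀ => ?_
    have e := fun h =>
      ih (f.restrict {t | SatPL M t φ₀} {t | SatPL N t φ₀} fun t => (f.satPL_iff t φ₀).symm) ⟨s, h⟩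
    exact ⟨fun H h => (e h).1 (H ((f.satPL_iff s φ₀).2 h)),
      fun H h => (e ((f.satPL_iff s φ₀).1 h)).2 (H _)⟩

theorem sat_restrict_congr {A P : Type} {M : Model A P} {X Y : Set M.S} (hXY : X = Y) {s : M.S}
    (hX : s ∈ X) (hY : s ∈ Y) (φ : Form A P) :
    Sat (M.restrict X) ⟨s, hX⟩ φ ↔ Sat (M.restrict Y) ⟨s, hY⟩ φ := by
  subst hXY
  rfl

theorem sat_ann_congr {A P : Type} {φ φ' ψ ψ' : Form A P}
    (hφ : ∀ (M : Model A P) (s : M.S), Sat M s φ ↔ Sat M s φ')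
    (hψ : ∀ (M : Model A P) (s : M.S), Sat M s ψ ↔ Sat M s ψ') (M : Model A P) (s : M.S) :
    Sat M s (.ann φ ψ) ↔ Sat M s (.ann φ' ψ') := by
  have e : {t | Sat M t φ} = {t | Sat M t φ'} := Set.ext (hφ M)
  exact ⟨fun H h => (hψ _ _).1 ((sat_restrict_congr e ((hφ M s).2 h) h ψ).1 (H _)),
    fun H h => (sat_restrict_congr e h ((hφ M s).1 h) ψ).2 ((hψ _ _).2 (H _))⟩

theorem sat_imp {A P : Type} {M : Model A P} {s : M.S} {φ ψ : Form A P} :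
    Sat M s (φ.imp ψ) ↔ (Sat M s φ → Sat M s ψ) := by
  simp [Form.imp, Sat]

theorem sat_ann_ann {A P : Type} (α β χ : Form A P) (M : Model A P) (s : M.S) :
    Sat M s (.ann α (.ann β χ)) ↔ Sat M s (.ann (.and α (.ann α β)) χ) := by
  have hmem : ∀ t, Sat M t (.and α (.ann α β)) ↔
      ∃ h : Sat M t α, Sat (M.restrict {t | Sat M t α}) ⟨t, h⟩ β := fun t =>
    ⟨fun h => ⟨h.1, h.2 h.1⟩, fun ⟨h₁, h₂⟩ => ⟨h₁, fun _ => h₂⟩⟩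
  let f := M.restrictRestrictIso {t | Sat M t α}
    {t | Sat (M.restrict {t | Sat M t α}) t β} {t | Sat M t (.and α (.ann α β))} hmem
  constructor
  · intro H h
    obtain ⟨h₁, h₂⟩ := (hmem s).1 h
    exact (Model.Iso.sat_iff χ f ⟨⟨s, h₁⟩, h₂⟩).2 (H h₁ h₂)
  · intro H h₁ h₂
    exact (Model.Iso.sat_iff χ f ⟨⟨s, h₁⟩, h₂⟩).1 (H ((hmem s).2 ⟨h₁, h₂⟩))

/-- Push the announcement of `α` through a formula, stopping at `□`. -/
def Form.announce {A P : Type} (α : Form A P) : Form A P → Form A P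
  | .atom p => α.imp (.atom p)
  | .neg φ => α.imp (.neg (α.announce φ))
  | .and φ ψ => .and (α.announce φ) (α.announce ψ)
  | .know a φ => α.imp (.know a (α.announce φ))
  | .ann β χ => .ann (.and α (α.announce β)) χ
  | .box χ => .ann α (.box χ)

theorem sat_announce {A P : Type} (α φ : Form A P) :
    ∀ (M : Model A P) (s : M.S), Sat M s (α.announce φ) ↔ Sat M s (.ann α φ) := by
  induction φ with
  | atom p => exact fun M s => sat_imp
  | neg φ ih =>
    intro M s
    rw [Form.announce, sat_imp]
    simp only [Sat, ih]
    exact ⟨fun H h h' => H h fun _ => h', fun H h h' => H h (h' h)⟩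
  | and φ ψ ih₁ ih₂ =>
    intro M s
    simp only [Form.announce, Sat, ih₁, ih₂]
    exact forall_and.symm
  | know a φ ih =>
    intro M s
    rw [Form.announce, sat_imp]
    simp only [Sat, ih]
    exact ⟨fun H h t hst => H h t.val hst t.property, fun H h t hst ht => H h ⟨t, ht⟩ hst⟩
  | ann β χ ih =>
    intro M s
    rw [sat_ann_ann]
    refine sat_ann_congr (fun M s => ?_) (fun _ _ => Iff.rfl) M s
    exact and_congr_right fun _ => ih M s
  | box χ => exact fun M s => Iff.rfl

theorem IsAANF.imp {A P : Type} {φ ψ : Form A P} (hφ : IsAANF φ) (hψ : IsAANF ψ) :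
    IsAANF (φ.imp ψ) :=
  .neg (.and hφ (.neg hψ))

theorem IsAANF.announce {A P : Type} {α φ : Form A P} (hα : IsAANF α) (hφ : IsAANF φ) :
    IsAANF (α.announce φ) := by
  induction hφ with
  | atom p => exact hα.imp (.atom p)
  | neg _ ih => exact hα.imp (.neg ih)
  | and _ _ ih₁ ih₂ => exact .and ih₁ ih₂
  | know a _ ih => exact hα.imp (.know a ih)
  | annbox _ hψ ih => exact .annbox (.and hα ih) hψ

theorem sat_ann_of_forall_sat {A P : Type} {α : Form A P}
    (hα : ∀ (M : Model A P) (s : M.S), Sat M s α) (φ : Form A P) (M : Model A P) (s : M.S) :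
    Sat M s (.ann α φ) ↔ Sat M s φ := by
  let f : (M.restrict {t | Sat M t α}).Iso M :=
    { toEquiv := Equiv.subtypeUnivEquiv (hα M)
      rel_iff := fun _ _ _ => Iff.rfl
      val_iff := fun _ _ => Iff.rfl }
  exact ⟨fun H => (Model.Iso.sat_iff φ f ⟨s, hα M s⟩).2 (H (hα M s)),
    fun H h => (Model.Iso.sat_iff φ f ⟨s, h⟩).1 H⟩

theorem exists_aanf_forall_sat_iff {A P : Type} [Inhabited P] (φ : Form A P) :
    ∃ ψ : Form A P, IsAANF ψ ∧ ∀ (M : Model A P) (s : M.S), Sat M s φ ↔ Sat M s ψ := by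
  induction φ with
  | atom p => exact ⟨_, .atom p, fun _ _ => Iff.rfl⟩
  | neg φ ih =>
    obtain ⟨φ', h, e⟩ := ih
    exact ⟨_, .neg h, fun M s => not_congr (e M s)⟩
  | and φ ψ ih₁ ih₂ =>
    obtain ⟨φ', h₁, e₁⟩ := ih₁
    obtain ⟨ψ', h₂, e₂⟩ := ih₂
    exact ⟨_, .and h₁ h₂, fun M s => and_congr (e₁ M s) (e₂ M s)⟩
  | know a φ ih =>
    obtain ⟨φ', h, e⟩ := ih
    exact ⟨_, .know a h, fun M s => forall_congr' fun t => imp_congr_right fun _ => e M t⟩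
  | ann φ ψ ih₁ ih₂ =>
    obtain ⟨φ', h₁, e₁⟩ := ih₁
    obtain ⟨ψ', h₂, e₂⟩ := ih₂
    exact ⟨_, IsAANF.announce h₁ h₂, fun M s =>
      (sat_ann_congr e₁ e₂ M s).trans (sat_announce φ' ψ' M s).symm⟩
  | box ψ ih =>
    obtain ⟨ψ', h, e⟩ := ih
    refine ⟨_, .annbox (IsAANF.imp (.atom default) (.atom default)) h, fun M s => ?_⟩
    rw [sat_ann_of_forall_sat fun _ _ => sat_imp.2 id]
    exact forall_congr' fun φ₀ => forall_congr' fun _ => e _ _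

/-- every L_BAPAL formula is semantically equivalent to a formula in
arbitrary announcement normal form. -/
theorem exists_aanf_equivalent {A : Type} [Countable A] (φ : Form A ℕ) :
    ∃ ψ : Form A ℕ, IsAANF ψ ∧
      ∀ M : Model A ℕ, M.IsEpistemic → ∀ s : M.S, (Sat M s φ ↔ Sat M s ψ) := by
  obtain ⟨ψ, hψ, e⟩ := exists_aanf_forall_sat_iff φ
  exact ⟨ψ, hψ, fun M _ s => e M s⟩
end

section
/- The derivation rule R□¹ is sound: if ψ(♯) is a necessity form, p is an atom occurring neither in ψ(♯) nor in φ, and ψ([p]φ) is valid, then ψ(□φ) is valid. -/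
/-- Necessity forms: `♯ | φ → ψ(♯) | K_a ψ(♯) | [φ]ψ(♯)`. -/
inductive NecForm (A P : Type) : Type
  | hole : NecForm A P
  | imp : Form A P → NecForm A P → NecForm A P
  | know : A → NecForm A P → NecForm A P
  | ann : Form A P → NecForm A P → NecForm A P

/-- Substitution of a formula for the placeholder `♯` in a necessity form. -/
def NecForm.subst {A P : Type} : NecForm A P → Form A P → Form A P
  | .hole, χ => χ
  | .imp φ nf, χ => Form.imp φ (nf.subst χ)
  | .know a nf, χ => .know a (nf.subst χ)
  | .ann φ nf, χ => .ann φ (nf.subst χ)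

/-- An atom occurring in a necessity form. -/
def NecForm.occurs {A P : Type} (q : P) : NecForm A P → Prop
  | .hole => False
  | .imp φ nf => φ.occurs q ∨ nf.occurs q
  | .know _ nf => nf.occurs q
  | .ann φ nf => φ.occurs q ∨ nf.occurs q

theorem satPL_restrict {A P : Type} (M : Model A P) (X : Set M.S) (s : X) (β : PLForm P) :
    SatPL (M.restrict X) s β ↔ SatPL M s.val β := by
  induction β with
  | atom q => rfl
  | neg β ih => exact not_congr ih
  | and β γ ihβ ihγ => exact and_congr ihβ ihγ

/-- Simultaneous substitution of boolean formulas for atoms. -/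
def PLForm.bind {P Q : Type} (f : P → PLForm Q) : PLForm P → PLForm Q
  | .atom q => f q
  | .neg β => .neg (β.bind f)
  | .and β γ => .and (β.bind f) (γ.bind f)

theorem satPL_bind {A P Q : Type} {M : Model A P} {N : Model A Q} {s : M.S} {t : N.S}
    {f : P → PLForm Q} (h : ∀ q, M.val q s ↔ SatPL N t (f q)) (β : PLForm P) :
    SatPL M s β ↔ SatPL N t (β.bind f) := by
  induction β with
  | atom q => exact h q
  | neg β ih => exact not_congr ih
  | and β γ ihβ ihγ => exact and_congr ihβ ihγ

/-- An isomorphism of frames which preserves the atoms in `Q` and under which both models have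
the same boolean definable sets. -/
structure BoolIso {A P : Type} (Q : Set P) (M N : Model A P) where
  toEquiv : M.S ≃ N.S
  rel_iff : ∀ a s t, N.rel a (toEquiv s) (toEquiv t) ↔ M.rel a s t
  val_iff : ∀ q ∈ Q, ∀ s, N.val q (toEquiv s) ↔ M.val q s
  exists_right : ∀ β, ∃ γ, ∀ s, SatPL M s β ↔ SatPL N (toEquiv s) γ
  exists_left : ∀ γ, ∃ β, ∀ s, SatPL M s β ↔ SatPL N (toEquiv s) γ

namespace BoolIso

variable {A P : Type} {Q : Set P} {M N : Model A P}

/-- A boolean isomorphism restricts to submodels with corresponding domains. -/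
def restrict (e : BoolIso Q M N) {X : Set M.S} {Y : Set N.S}
    (h : ∀ s, s ∈ X ↔ e.toEquiv s ∈ Y) : BoolIso Q (M.restrict X) (N.restrict Y) where
  toEquiv := e.toEquiv.subtypeEquiv h
  rel_iff a s t := e.rel_iff a s.val t.val
  val_iff q hq s := e.val_iff q hq s.val
  exists_right β := by
    obtain ⟨γ, hγ⟩ := e.exists_right β
    exact ⟨γ, fun s => (satPL_restrict M X s β).trans
      ((hγ s.val).trans (satPL_restrict N Y ⟨_, (h s.val).1 s.2⟩ γ).symm)⟩
  exists_left γ := by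
    obtain ⟨β, hβ⟩ := e.exists_left γ
    exact ⟨β, fun s => (satPL_restrict M X s β).trans
      ((hβ s.val).trans (satPL_restrict N Y ⟨_, (h s.val).1 s.2⟩ γ).symm)⟩

theorem sat_iff (e : BoolIso Q M N) (χ : Form A P) (hχ : ∀ q, χ.occurs q → q ∈ Q) (s : M.S) :
    Sat N (e.toEquiv s) χ ↔ Sat M s χ := by
  induction χ generalizing M N with
  | atom q => exact e.val_iff q (hχ q rfl) s
  | neg χ ih => exact not_congr (ih e hχ s)
  | and χ θ ihχ ihθ =>
    exact and_congr (ihχ e (fun q hq => hχ q (.inl hq)) s) (ihθ e (fun q hq => hχ q (.inr hq)) s)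
  | know a χ ih =>
    simp only [Sat]
    rw [← e.toEquiv.forall_congr_right]
    exact forall_congr' fun t => imp_congr (e.rel_iff a s t) (ih e hχ t)
  | ann χ θ ihχ ihθ =>
    have hs := ihχ e (fun q hq => hχ q (.inl hq))
    simp only [Sat]
    have key (h : Sat M s χ) := ihθ
      (e.restrict (Y := {t | Sat N t χ}) fun t => (hs t).symm) (fun q hq => hχ q (.inr hq)) ⟨s, h⟩
    exact ⟨fun H h => (key h).1 (H ((hs s).2 h)), fun H h => (key ((hs s).1 h)).2 (H _)⟩
  | box χ ih =>
    simp only [Sat]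
    constructor
    · intro H β h
      obtain ⟨γ, hγ⟩ := e.exists_right β
      exact (ih (e.restrict hγ) hχ ⟨s, h⟩).1 (H γ ((hγ s).1 h))
    · intro H γ h
      obtain ⟨β, hβ⟩ := e.exists_left γ
      exact (ih (e.restrict hβ) hχ ⟨s, (hβ s).2 h⟩).2 (H β ((hβ s).2 h))

end BoolIso

/-- A refutation of `ψ(□φ)` yields a boolean formula `β` such that `ψ([p]φ)` fails in every
boolean-isomorphic model in which the fresh atom `p` denotes `β`. -/
theorem exists_forall_not_sat_subst_ann {A P : Type} {Q : Set P} {φ : Form A P} (p : P)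
    (hφ : ∀ q, φ.occurs q → q ∈ Q) (nf : NecForm A P) (hnf : ∀ q, nf.occurs q → q ∈ Q)
    (M : Model A P) (s : M.S) (h : ¬ Sat M s (nf.subst (.box φ))) :
    ∃ β, ∀ (N : Model A P) (e : BoolIso Q M N),
      (∀ t, N.val p (e.toEquiv t) ↔ SatPL M t β) →
        ¬ Sat N (e.toEquiv s) (nf.subst (.ann (.atom p) φ)) := by
  induction nf generalizing M with
  | hole =>
    simp only [NecForm.subst, Sat, not_forall] at h
    obtain ⟨β, hβ, h⟩ := h
    refine ⟨β, fun N e hp H => h ?_⟩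
    exact ((e.restrict (Y := {t | N.val p t}) fun t => (hp t).symm).sat_iff φ hφ ⟨s, hβ⟩).1
      (H ((hp s).2 hβ))
  | imp χ nf ih =>
    simp only [NecForm.subst, Form.imp, Sat, not_not] at h
    obtain ⟨β, hβ⟩ := ih (fun q hq => hnf q (.inr hq)) M s h.2
    refine ⟨β, fun N e hp H => H ⟨?_, hβ N e hp⟩⟩
    exact (e.sat_iff χ (fun q hq => hnf q (.inl hq)) s).2 h.1
  | know a nf ih =>
    simp only [NecForm.subst, Sat, not_forall] at h
    obtain ⟨t, hst, h⟩ := h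
    obtain ⟨β, hβ⟩ := ih hnf M t h
    exact ⟨β, fun N e hp H => hβ N e hp (H _ ((e.rel_iff a s t).2 hst))⟩
  | ann χ nf ih =>
    simp only [NecForm.subst, Sat, not_forall] at h
    obtain ⟨hs, h⟩ := h
    obtain ⟨β, hβ⟩ := ih (fun q hq => hnf q (.inr hq)) _ _ h
    refine ⟨β, fun N e hp H => ?_⟩
    have hχ := e.sat_iff χ (fun q hq => hnf q (.inl hq))
    refine hβ _ (e.restrict (Y := {t | Sat N t χ}) fun t => (hχ t).symm) (fun t => ?_)
      (H ((hχ s).2 hs))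
    exact (hp t.val).trans (satPL_restrict M _ t β).symm

theorem Form.finite_occurs {A P : Type} (χ : Form A P) : {q | χ.occurs q}.Finite := by
  induction χ with
  | atom p => exact (Set.finite_singleton p).subset fun q hq => Eq.symm hq
  | neg χ ih => exact ih
  | and χ θ ihχ ihθ => exact ihχ.union ihθ
  | know a χ ih => exact ih
  | ann χ θ ihχ ihθ => exact ihχ.union ihθ
  | box χ ih => exact ih

theorem NecForm.finite_occurs {A P : Type} (nf : NecForm A P) : {q | nf.occurs q}.Finite := by
  induction nf with
  | hole => exact Set.finite_empty
  | imp χ nf ih => exact χ.finite_occurs.union ih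
  | know a nf ih => exact ih
  | ann χ nf ih => exact χ.finite_occurs.union ih

/-- The atom `p` can be made to denote any boolean formula `β` by moving its former value to an
atom outside the finite set `Q`, up to boolean isomorphism. -/
theorem exists_boolIso_val_iff {A : Type} {Q : Set ℕ} (hQ : Q.Finite) {p : ℕ} (hp : p ∉ Q)
    {M : Model A ℕ} (hM : M.IsEpistemic) (β : PLForm ℕ) :
    ∃ (N : Model A ℕ) (e : BoolIso Q M N), N.IsEpistemic ∧
      ∀ t, N.val p (e.toEquiv t) ↔ SatPL M t β := by
  obtain ⟨m, hm⟩ := (hQ.insert p).bddAbove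
  have hpm : p ≤ m := hm (Set.mem_insert p Q)
  let f (q : ℕ) : PLForm ℕ :=
    if q = p then β else if q ≤ m then .atom q else if q = m + 1 then .atom p else .atom (q - 1)
  let g (q : ℕ) : ℕ := if q = p then m + 1 else if q ≤ m then q else q + 1
  have hf : f p = β := if_pos rfl
  have hfQ (q) (hq : q ∈ Q) : f q = .atom q := by
    have h1 : q ≠ p := fun h => hp (h ▸ hq)
    have h2 : q ≤ m := hm (Set.mem_insert_of_mem p hq)
    simp [f, h1, h2]
  have hfg (q) : f (g q) = .atom q := by
    dsimp only [f, g]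
    split_ifs <;> first | omega | simp_all
  let N : Model A ℕ := ⟨M.S, M.rel, fun q s => SatPL M s (f q)⟩
  refine ⟨N, ⟨Equiv.refl _, fun _ _ _ => Iff.rfl, fun q hq s => ?_, fun γ => ?_, fun γ => ?_⟩,
    hM, fun t => ?_⟩
  · change SatPL M s (f q) ↔ _
    rw [hfQ q hq]
    rfl
  · refine ⟨γ.bind fun q => .atom (g q), fun s => satPL_bind (fun q => ?_) γ⟩
    change _ ↔ SatPL M s (f (g q))
    rw [hfg]
    rfl
  · exact ⟨γ.bind f, fun s => (satPL_bind (M := N) (N := M) (s := s) (fun q => Iff.rfl) γ).symm⟩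
  · change SatPL M t (f p) ↔ _
    rw [hf]

/-- soundness of the rule R□¹: if `ψ(♯)` is a necessity form, the atom
`p` occurs neither in `ψ(♯)` nor in `φ`, and `ψ([p]φ)` is valid, then `ψ(□φ)` is
valid. -/
theorem rbox_one_sound {A : Type} [Countable A]
    (nf : NecForm A ℕ) (φ : Form A ℕ) (p : ℕ)
    (hnf : ¬ nf.occurs p) (hφ : ¬ φ.occurs p)
    (h : Valid (nf.subst (.ann (.atom p) φ))) :
    Valid (nf.subst (.box φ)) := by
  intro M hM s
  by_contra hs
  let Q : Set ℕ := {q | nf.occurs q} ∪ {q | φ.occurs q}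
  obtain ⟨β, hβ⟩ := exists_forall_not_sat_subst_ann (Q := Q) p (fun q => .inr) nf (fun q => .inl)
    M s hs
  obtain ⟨N, e, hN, hp⟩ := exists_boolIso_val_iff
    (nf.finite_occurs.union φ.finite_occurs : Q.Finite) (not_or.2 ⟨hnf, hφ⟩) hM β
  exact hβ N e hp (h N hN _)
end
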